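/- arXiv:1502.01074 — 2 statements merged into one kernel-verified Lean document; each statement's English description precedes it below -/
import Mathlib

section
/- Let G = (V,E) be a rooted simple directed graph and let w ∈ Sp[V]. If 𝔸_G(w) is nonempty, then V_w = {i ∈ V : w_i ≠ 0} is contained in the root set V_r of G. -/
open Matrix Finset
open scoped Classical

noncomputable section

/-- `A` is an infinitesimal stochastic matrix (ISM): all off-diagonal entries are
nonnegative and every row sums to zero. -/
def IsISM {n : ℕ} (A : Matrix (Fin n) (Fin n) ℝ) : Prop :=
  (∀ i j, i ≠ j → 0 ≤ A i j) ∧ ∀ i, ∑ j, A i j = 0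

/-- `A` has the zero pattern prescribed by the digraph with edge relation `E`:
`A i j = 0` whenever `i ≠ j` and `i → j` is not an edge. -/
def InPattern {n : ℕ} (E : Fin n → Fin n → Prop) (A : Matrix (Fin n) (Fin n) ℝ) : Prop :=
  ∀ i j, i ≠ j → ¬ E i j → A i j = 0

/-- `r` is a root of the digraph `E`: every vertex has a directed path to `r`. -/
def IsRootOf {n : ℕ} (E : Fin n → Fin n → Prop) (r : Fin n) : Prop :=
  ∀ i, Relation.ReflTransGen E i r

/-- The digraph `E` is rooted. -/
def Rooted {n : ℕ} (E : Fin n → Fin n → Prop) : Prop :=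
  ∃ r, IsRootOf E r

/-- `w` lies in the standard simplex `Sp[V]`. -/
def MemSimplex {n : ℕ} (w : Fin n → ℝ) : Prop :=
  (∀ i, 0 ≤ w i) ∧ ∑ i, w i = 1

/-- `0` is a simple eigenvalue of `A`: it is a root of multiplicity exactly one of
the characteristic polynomial of `A`. -/
def SimpleZeroEig {n : ℕ} (A : Matrix (Fin n) (Fin n) ℝ) : Prop :=
  Polynomial.rootMultiplicity 0 (Matrix.charpoly A) = 1

/-- `A ∈ 𝔸_G(w)`: the set of `w`-feasible dynamics. -/
def Feasible {n : ℕ} (E : Fin n → Fin n → Prop) (w : Fin n → ℝ)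
    (A : Matrix (Fin n) (Fin n) ℝ) : Prop :=
  IsISM A ∧ InPattern E A ∧ SimpleZeroEig A ∧ Aᵀ *ᵥ w = 0

/-- `S` is a relevant subset of the digraph `E`: it consists of roots and the induced
subgraph on `S` is strongly connected (paths staying inside `S`). -/
def RelevantSubset {n : ℕ} (E : Fin n → Fin n → Prop) (S : Set (Fin n)) : Prop :=
  (∀ i ∈ S, IsRootOf E i) ∧
    ∀ i ∈ S, ∀ j ∈ S, Relation.ReflTransGen (fun a b => E a b ∧ a ∈ S ∧ b ∈ S) i j

/-- Any vector of the left kernel of `A` is a multiple of a given nonzero one, when `0` is a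
simple eigenvalue of `A`. -/
theorem SimpleZeroEig.exists_smul_eq {n : ℕ} {A : Matrix (Fin n) (Fin n) ℝ}
    (hA : SimpleZeroEig A) {u v : Fin n → ℝ} (hu : Aᵀ *ᵥ u = 0) (hv : Aᵀ *ᵥ v = 0)
    (hv0 : v ≠ 0) : ∃ c : ℝ, c • v = u := by
  have hle : Module.finrank ℝ (Module.End.eigenspace (Matrix.toLin' Aᵀ) 0) ≤ 1 := by
    refine (LinearMap.finrank_eigenspace_le _ _).trans ?_
    rw [Matrix.charpoly_toLin', Matrix.charpoly_transpose]
    exact hA.le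
  have hmem : ∀ x : Fin n → ℝ, Aᵀ *ᵥ x = 0 →
      x ∈ Module.End.eigenspace (Matrix.toLin' Aᵀ) (0 : ℝ) := fun x hx => by
    rw [Module.End.mem_eigenspace_iff, Matrix.toLin'_apply, hx, zero_smul]
  obtain ⟨z, hz⟩ := finrank_le_one_iff.mp hle
  obtain ⟨a, ha⟩ := hz ⟨u, hmem u hu⟩
  obtain ⟨b, hb⟩ := hz ⟨v, hmem v hv⟩
  have ha' : a • (z : Fin n → ℝ) = u := congrArg Subtype.val ha
  have hb' : b • (z : Fin n → ℝ) = v := congrArg Subtype.val hb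
  have hb0 : b ≠ 0 := by
    rintro rfl
    exact hv0 (by rw [← hb', zero_smul])
  exact ⟨a / b, by rw [← hb', smul_smul, div_mul_cancel₀ a hb0, ha']⟩

/-- If the rows of `A` sum to zero and no entry of `A` leads out of the nonempty set `S`, then
the left kernel of `A` has a nonzero vector supported in `S`. -/
theorem exists_left_kernel_of_closed {n : ℕ} {A : Matrix (Fin n) (Fin n) ℝ}
    (hrow : ∀ i, ∑ j, A i j = 0) {S : Set (Fin n)} (hS : S.Nonempty)
    (hclosed : ∀ i ∈ S, ∀ j ∉ S, A i j = 0) :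
    ∃ v : Fin n → ℝ, v ≠ 0 ∧ (∀ i ∉ S, v i = 0) ∧ Aᵀ *ᵥ v = 0 := by
  let M : Matrix (Fin n) (Fin n) ℝ :=
    Matrix.of fun i j => if i ∈ S then A i j else if i = j then 1 else 0
  have hdet : M.det = 0 := by
    refine Matrix.exists_mulVec_eq_zero_iff.mp ⟨fun i => if i ∈ S then 1 else 0, ?_, ?_⟩
    · obtain ⟨r, hr⟩ := hS
      intro h
      simpa [hr] using congrFun h r
    · ext i
      by_cases hi : i ∈ S
      · refine Eq.trans ?_ (hrow i)
        simp only [Matrix.mulVec, dotProduct]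
        refine Finset.sum_congr rfl fun j _ => ?_
        by_cases hj : j ∈ S
        · simp [M, hi, hj]
        · simp [hj, hclosed i hi j hj]
      · simp only [Matrix.mulVec, dotProduct, Pi.zero_apply]
        refine Finset.sum_eq_zero fun j _ => ?_
        by_cases hj : j ∈ S
        · have hij : i ≠ j := fun h => hi (h ▸ hj)
          simp [M, hi, hij]
        · simp [hj]
  obtain ⟨v, hv0, hv⟩ := Matrix.exists_vecMul_eq_zero_iff.mpr hdet
  have hvS : ∀ j ∉ S, v j = 0 := by
    intro j hj
    have hsum : ∑ i, v i * M i j = v j := by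
      rw [Finset.sum_eq_single j]
      · simp [M, hj]
      · intro i _ hij
        by_cases hi : i ∈ S
        · simp [M, hi, hclosed i hi j hj]
        · simp [M, hi, hij]
      · simp
    rw [← hsum]
    exact congrFun hv j
  refine ⟨v, hv0, hvS, ?_⟩
  rw [Matrix.mulVec_transpose, ← hv]
  ext j
  simp only [Matrix.vecMul, dotProduct]
  refine Finset.sum_congr rfl fun i _ => ?_
  by_cases hi : i ∈ S
  · simp [M, hi]
  · simp [hvS i hi]

/-- If no entry of the ISM `A` leads out of `S`, then a nonnegative left kernel vector of `A`
remains in the left kernel when its coordinates in `S` are replaced by zero. -/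
theorem IsISM.left_kernel_indicator_compl {n : ℕ} {A : Matrix (Fin n) (Fin n) ℝ}
    (hA : IsISM A) {S : Set (Fin n)} (hclosed : ∀ i ∈ S, ∀ j ∉ S, A i j = 0)
    {w : Fin n → ℝ} (hw0 : ∀ i, 0 ≤ w i) (hw : Aᵀ *ᵥ w = 0) :
    Aᵀ *ᵥ (Sᶜ.indicator w) = 0 := by
  have hbal : ∀ j, ∑ i, A i j * w i = 0 := fun j => congrFun hw j
  have hnonneg : ∀ i, 0 ≤ ∑ j, if j ∈ S then A i j * Sᶜ.indicator w i else 0 := by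
    refine fun i => Finset.sum_nonneg fun j _ => ?_
    by_cases hi : i ∈ S
    · simp [hi]
    by_cases hj : j ∈ S
    · have hij : i ≠ j := fun h => hi (h ▸ hj)
      simpa [hi, hj] using mul_nonneg (hA.1 i j hij) (hw0 i)
    · simp [hj]
  have hinside : ∀ i ∈ S, ∑ j, (if j ∈ S then A i j * w i else 0) = 0 := by
    intro i hi
    calc ∑ j, (if j ∈ S then A i j * w i else 0) = ∑ j, A i j * w i := by
          refine Finset.sum_congr rfl fun j _ => ?_
          by_cases hj : j ∈ S
          · simp [hj]
          · simp [hj, hclosed i hi j hj]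
      _ = 0 := by rw [← Finset.sum_mul, hA.2 i, zero_mul]
  have htotal : ∑ i, ∑ j, (if j ∈ S then A i j * Sᶜ.indicator w i else 0) = 0 := by
    calc ∑ i, ∑ j, (if j ∈ S then A i j * Sᶜ.indicator w i else 0)
        = ∑ i, ∑ j, (if j ∈ S then A i j * w i else 0) := by
          refine Finset.sum_congr rfl fun i _ => ?_
          by_cases hi : i ∈ S
          · rw [hinside i hi]
            simp [hi]
          · simp [hi]
      _ = ∑ j, ∑ i, (if j ∈ S then A i j * w i else 0) := Finset.sum_comm
      _ = 0 := by
          refine Finset.sum_eq_zero fun j _ => ?_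
          by_cases hj : j ∈ S
          · simpa [hj] using hbal j
          · simp [hj]
  have hflow : ∀ i, ∀ j ∈ S, A i j * Sᶜ.indicator w i = 0 := by
    intro i j hj
    by_cases hi : i ∈ S
    · simp [hi]
    have hsum := (Finset.sum_eq_zero_iff_of_nonneg fun i _ => hnonneg i).mp htotal i
      (Finset.mem_univ i)
    have hterm : ∀ k ∈ Finset.univ,
        0 ≤ if k ∈ S then A i k * Sᶜ.indicator w i else 0 := by
      intro k _
      by_cases hk : k ∈ S
      · have hik : i ≠ k := fun h => hi (h ▸ hk)
        simpa [hi, hk] using mul_nonneg (hA.1 i k hik) (hw0 i)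
      · simp [hk]
    have := (Finset.sum_eq_zero_iff_of_nonneg hterm).mp hsum j (Finset.mem_univ j)
    rwa [if_pos hj] at this
  ext j
  simp only [Matrix.mulVec, dotProduct, Matrix.transpose_apply]
  by_cases hj : j ∈ S
  · exact Finset.sum_eq_zero fun i _ => hflow i j hj
  · rw [Pi.zero_apply, ← hbal j]
    refine Finset.sum_congr rfl fun i _ => ?_
    by_cases hi : i ∈ S
    · simp [hi, hclosed i hi j hj]
    · simp [hi]

/-- Lemma 1: if `𝔸_G(w)` is nonempty, then the support of `w` is contained in the
root set of the rooted digraph `G`. -/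
theorem support_subset_roots_of_feasible_nonempty
    (n : ℕ) (hn : 1 ≤ n) (E : Fin n → Fin n → Prop) (hsimple : ∀ i, ¬ E i i)
    (hrooted : Rooted E) (w : Fin n → ℝ) (hw : MemSimplex w)
    (hne : ∃ A, Feasible E w A) :
    ∀ i, w i ≠ 0 → IsRootOf E i := by
  obtain ⟨A, hism, hpat, hsimp, hker⟩ := hne
  let S : Set (Fin n) := {r | IsRootOf E r}
  have hclosed : ∀ i ∈ S, ∀ j ∉ S, A i j = 0 := fun i hi j hj =>
    hpat i j (fun h => hj (h ▸ hi)) fun hE => hj fun k => (hi k).tail hE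
  obtain ⟨v, hv0, hvS, hv⟩ := exists_left_kernel_of_closed hism.2 hrooted hclosed
  have hu := hism.left_kernel_indicator_compl hclosed hw.1 hker
  obtain ⟨c, hc⟩ := hsimp.exists_smul_eq hu hv hv0
  intro i hi
  by_contra hiS
  have h := congrFun hc i
  rw [Pi.smul_apply, hvS i hiS, smul_zero,
    Set.indicator_of_mem (show i ∈ Sᶜ from hiS)] at h
  exact hi h.symm
end
end

section
/- Let G be a simple directed graph on n vertices, let w ∈ Sp(V), let G_1,…,G_k be the cycles of G with associated ISMs C_1,…,C_k, and suppose k ≥ 1. Then Â_G(w) = Co[C_1,…,C_k], i.e. the set of relaxed w-feasible dynamics equals the convex cone of all nonnegative linear combinations of the cycle matrices C_1,…,C_k. -/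
open Matrix Finset
open scoped Classical

noncomputable section

/-- `c` is (the edge relation of) a cycle of the digraph `E`: there are distinct
vertices `v 0, …, v (m+1)` (hence at least two of them), each edge `v t → v (t+1)`
(indices cyclic) is an edge of `E`, and the edges of `c` are exactly these edges. -/
def IsCycleOf {n : ℕ} (E : Fin n → Fin n → Prop) (c : Fin n → Fin n → Prop) : Prop :=
  ∃ (m : ℕ) (v : Fin (m + 2) → Fin n), Function.Injective v ∧
    (∀ t, E (v t) (v (t + 1))) ∧
    ∀ i j, c i j ↔ ∃ t, v t = i ∧ v (t + 1) = j

/-- The ISM associated with a cycle `c` and the weight vector `w`: off-diagonal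
entries are `1 / w j` on the edges of the cycle and `0` otherwise, and the diagonal
entries are chosen so that every row sums to zero. -/
noncomputable def cycleISM {n : ℕ} (w : Fin n → ℝ) (c : Fin n → Fin n → Prop) :
    Matrix (Fin n) (Fin n) ℝ :=
  Matrix.of fun i j =>
    if i = j then -(∑ l ∈ Finset.univ.erase i, if c i l then (w i)⁻¹ else 0)
    else if c i j then (w i)⁻¹ else 0

/-- A nonnegative flow on the arcs of the complete digraph, without loops and with equal inflow
and outflow at every vertex. -/
structure IsCirculation {n : ℕ} (f : Fin n → Fin n → ℝ) : Prop where
  nonneg : ∀ i j, 0 ≤ f i j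
  loopless : ∀ i, f i i = 0
  balanced : ∀ j, ∑ i, f i j = ∑ i, f j i

/-- The indicator function of a relation. -/
def arcIndicator {n : ℕ} (c : Fin n → Fin n → Prop) (i j : Fin n) : ℝ :=
  if c i j then 1 else 0

lemma IsCycleOf.le {n : ℕ} {E c : Fin n → Fin n → Prop} (hc : IsCycleOf E c) {i j : Fin n}
    (h : c i j) : E i j := by
  obtain ⟨m, v, -, hE, hiff⟩ := hc
  obtain ⟨t, rfl, rfl⟩ := (hiff i j).1 h
  exact hE t

lemma IsCycleOf.mono {n : ℕ} {E F c : Fin n → Fin n → Prop} (hc : IsCycleOf E c)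
    (h : ∀ i j, E i j → F i j) : IsCycleOf F c := by
  obtain ⟨m, v, hv, hE, hiff⟩ := hc
  exact ⟨m, v, hv, fun t => h _ _ (hE t), hiff⟩

lemma IsCycleOf.exists_arc {n : ℕ} {E c : Fin n → Fin n → Prop} (hc : IsCycleOf E c) :
    ∃ i j, c i j := by
  obtain ⟨m, v, -, -, hiff⟩ := hc
  exact ⟨v 0, v (0 + 1), (hiff _ _).2 ⟨0, rfl, rfl⟩⟩

lemma IsCycleOf.irrefl {n : ℕ} {E c : Fin n → Fin n → Prop} (hc : IsCycleOf E c) (i : Fin n) :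
    ¬ c i i := by
  obtain ⟨m, v, hv, -, hiff⟩ := hc
  intro h
  obtain ⟨t, h1, h2⟩ := (hiff i i).1 h
  have h3 : t + 1 = t := hv (h2.trans h1.symm)
  simp at h3

lemma IsCycleOf.isCirculation {n : ℕ} {E c : Fin n → Fin n → Prop} (hc : IsCycleOf E c) :
    IsCirculation (arcIndicator c) := by
  refine ⟨fun i j => ?_, fun i => if_neg (hc.irrefl i), ?_⟩
  · unfold arcIndicator
    split_ifs <;> norm_num
  obtain ⟨m, v, hv, -, hiff⟩ := hc
  have key : ∀ i j, arcIndicator c i j = ∑ t, if v t = i ∧ v (t + 1) = j then (1 : ℝ) else 0 := by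
    intro i j
    unfold arcIndicator
    split_ifs with h
    · obtain ⟨t, ht⟩ := (hiff i j).1 h
      rw [Finset.sum_eq_single_of_mem t (Finset.mem_univ _), if_pos ht]
      rintro s - hs
      exact if_neg fun h' => hs (hv (h'.1.trans ht.1.symm))
    · exact (Finset.sum_eq_zero fun t _ => if_neg fun h' => h ((hiff i j).2 ⟨t, h'⟩)).symm
  intro j
  have hin : ∀ t, ∑ i, (if v t = i ∧ v (t + 1) = j then (1 : ℝ) else 0) =
      if v (t + 1) = j then 1 else 0 := fun t => by simp [ite_and]
  have hout : ∀ t, ∑ i, (if v t = j ∧ v (t + 1) = i then (1 : ℝ) else 0) =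
      if v t = j then 1 else 0 := fun t => by by_cases h : v t = j <;> simp [h]
  simp only [key]
  rw [Finset.sum_comm, Finset.sum_comm (s := Finset.univ (α := Fin n))]
  simp only [hin, hout]
  exact Equiv.sum_comp (Equiv.addRight (1 : Fin (m + 2))) fun t => if v t = j then (1 : ℝ) else 0

/-- Following arcs out of the vertices of a nonempty set in which every vertex has a successor
eventually closes a cycle. -/
lemma exists_isCycleOf {n : ℕ} {E : Fin n → Fin n → Prop} (hE : ∀ i, ¬ E i i)
    (hsucc : ∀ i j, E i j → ∃ l, E j l) {a b : Fin n} (hab : E a b) :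
    ∃ c, IsCycleOf E c := by
  have : ∀ i, ∃ l, (∃ l, E i l) → E i l := fun i => by
    by_cases h : ∃ l, E i l
    · exact ⟨h.choose, fun _ => h.choose_spec⟩
    · exact ⟨i, fun h' => absurd h' h⟩
  choose g hg using this
  have step : ∀ s, E (g^[s] a) (g^[s + 1] a) := by
    intro s
    induction s with
    | zero => exact hg a ⟨b, hab⟩
    | succ s ih =>
      rw [Function.iterate_succ_apply' g (s + 1)]
      exact hg _ (hsucc _ _ ih)
  obtain ⟨s, s', hne, heq⟩ := Finite.exists_ne_map_eq_of_infinite fun s : ℕ => g^[s] a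
  wlog hlt : s < s' generalizing s s'
  · exact this s' s hne.symm heq.symm (by omega)
  set x := g^[s] a with hx
  have hper : Function.IsPeriodicPt g (s' - s) x := by
    change g^[s' - s] x = x
    rw [hx, ← Function.iterate_add_apply, Nat.sub_add_cancel hlt.le]
    exact heq.symm
  have stepx : ∀ t, E (g^[t] x) (g^[t + 1] x) := by
    intro t
    rw [hx, ← Function.iterate_add_apply, ← Function.iterate_add_apply]
    simpa only [add_right_comm] using step (t + s)
  have hpos := hper.minimalPeriod_pos (by omega)
  have hone : Function.minimalPeriod g x ≠ 1 := fun h => by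
    have hfix : g x = x := Function.minimalPeriod_eq_one_iff_isFixedPt.1 h
    have h0 := stepx 0
    simp only [Function.iterate_zero, id, zero_add, Function.iterate_one, hfix] at h0
    exact hE x h0
  obtain ⟨m, hm⟩ : ∃ m, Function.minimalPeriod g x = m + 2 :=
    ⟨Function.minimalPeriod g x - 2, by omega⟩
  refine ⟨fun i j => ∃ t : Fin (m + 2), g^[t] x = i ∧ g^[(t + 1 : Fin (m + 2))] x = j,
    m, fun t => g^[t] x, fun t t' h => ?_, fun t => ?_, fun i j => Iff.rfl⟩
  · exact Fin.ext (Function.iterate_injOn_Iio_minimalPeriod (by simp [hm]) (by simp [hm]) h)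
  · have h : g^[(t + 1 : Fin (m + 2))] x = g^[(t : ℕ) + 1] x := by
      rw [← Function.iterate_mod_minimalPeriod_eq (n := (t : ℕ) + 1), hm, Fin.val_add]
      simp
    simpa only [h] using stepx t

lemma IsCirculation.exists_isCycleOf {n : ℕ} {f : Fin n → Fin n → ℝ} (hf : IsCirculation f)
    {a b : Fin n} (hab : f a b ≠ 0) : ∃ c, IsCycleOf (fun i j => f i j ≠ 0) c := by
  refine _root_.exists_isCycleOf (fun i h => h (hf.loopless i)) (fun i j hij => ?_) hab
  by_contra! h
  have h0 : ∑ i, f i j = 0 := by rw [hf.balanced, Finset.sum_eq_zero fun l _ => h l]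
  exact hij ((Finset.sum_eq_zero_iff_of_nonneg fun l _ => hf.nonneg l j).1 h0 i
    (Finset.mem_univ _))

/-- Flow decomposition: a circulation supported on a digraph is a nonnegative combination of
the indicators of the cycles of that digraph. -/
lemma IsCirculation.eq_sum_cycles {n k : ℕ} {E : Fin n → Fin n → Prop}
    {Gc : Fin k → Fin n → Fin n → Prop} (hall : ∀ c, IsCycleOf E c → ∃ t, Gc t = c)
    {f : Fin n → Fin n → ℝ} (hf : IsCirculation f) (hfE : ∀ i j, f i j ≠ 0 → E i j) :
    ∃ α : Fin k → ℝ, (∀ t, 0 ≤ α t) ∧ ∀ i j, f i j = ∑ t, α t * arcIndicator (Gc t) i j := by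
  induction hN : (Finset.univ.filter fun p : Fin n × Fin n => f p.1 p.2 ≠ 0).card using
    Nat.strong_induction_on generalizing f with
  | _ N ih =>
    by_cases h0 : ∀ i j, f i j = 0
    · exact ⟨0, fun _ => le_rfl, fun i j => by simp [h0]⟩
    push Not at h0
    obtain ⟨a, b, hab⟩ := h0
    obtain ⟨c, hc⟩ := hf.exists_isCycleOf hab
    obtain ⟨s, rfl⟩ := hall c (hc.mono hfE)
    obtain ⟨p, hp, hmin⟩ := Finset.exists_min_image
      (Finset.univ.filter fun p : Fin n × Fin n => Gc s p.1 p.2) (fun p => f p.1 p.2)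
      (by obtain ⟨i, j, h⟩ := hc.exists_arc; exact ⟨(i, j), by simpa using h⟩)
    simp only [Finset.mem_filter, Finset.mem_univ, true_and, Prod.forall] at hp hmin
    set ε := f p.1 p.2 with hε
    let g : Fin n → Fin n → ℝ := fun i j => f i j - ε * arcIndicator (Gc s) i j
    have hg0 : ∀ i j, g i j ≠ 0 → f i j ≠ 0 := by
      intro i j hg h
      have hnc : ¬ Gc s i j := fun h' => hc.le h' h
      simp [g, arcIndicator, hnc, h] at hg
    have hci := hc.isCirculation
    have hg : IsCirculation g := by
      refine ⟨fun i j => ?_, fun i => ?_, fun j => ?_⟩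
      · by_cases h : Gc s i j
        · simpa [g, arcIndicator, h] using hmin i j h
        · simpa [g, arcIndicator, h] using hf.nonneg i j
      · simp [g, hf.loopless, hci.loopless]
      · simp only [g, Finset.sum_sub_distrib, ← Finset.mul_sum, hf.balanced, hci.balanced]
    obtain ⟨α, hα, hsum⟩ := ih _ (by
      rw [← hN]
      refine Finset.card_lt_card (Finset.ssubset_iff_of_subset ?_ |>.2 ⟨p, ?_, ?_⟩)
      · intro q
        simpa using hg0 q.1 q.2
      · simpa using hc.le hp
      · simp [g, arcIndicator, hp, ← hε]) hg (fun i j h => hfE i j (hg0 i j h)) rfl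
    refine ⟨α + Pi.single s ε, fun t => ?_, fun i j => ?_⟩
    · have hs : 0 ≤ (Pi.single s ε : Fin k → ℝ) := Pi.single_nonneg.2 (hf.nonneg p.1 p.2)
      exact add_nonneg (hα t) (hs t)
    · have h1 : f i j = g i j + ε * arcIndicator (Gc s) i j := by simp [g]
      simp [h1, hsum, add_mul, Finset.sum_add_distrib, Pi.single_apply]

/-- The off-diagonal flow `w i * A i j` of the matrix `A`. -/
def edgeFlow {n : ℕ} (w : Fin n → ℝ) (A : Matrix (Fin n) (Fin n) ℝ) (i j : Fin n) : ℝ :=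
  if i = j then 0 else w i * A i j

lemma transpose_mulVec_eq_zero_iff {n : ℕ} {w : Fin n → ℝ} {A : Matrix (Fin n) (Fin n) ℝ}
    (hA : ∀ i, ∑ j, A i j = 0) :
    Aᵀ *ᵥ w = 0 ↔ ∀ j, ∑ i, edgeFlow w A i j = ∑ i, edgeFlow w A j i := by
  have key : ∀ i j, edgeFlow w A i j = w i * A i j - if i = j then w i * A i j else 0 := by
    intro i j
    unfold edgeFlow
    split_ifs <;> simp
  rw [funext_iff]
  refine forall_congr' fun j => ?_
  simp only [key, Finset.sum_sub_distrib, Finset.sum_ite_eq, Finset.sum_ite_eq', Finset.mem_univ,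
    if_true, ← Finset.mul_sum, hA, mul_zero, Pi.zero_apply, Matrix.mulVec, dotProduct,
    Matrix.transpose_apply, sub_left_inj]
  simp only [mul_comm]

lemma edgeFlow_injective {n : ℕ} {w : Fin n → ℝ} (hw : ∀ i, 0 < w i)
    {A B : Matrix (Fin n) (Fin n) ℝ} (hA : ∀ i, ∑ j, A i j = 0) (hB : ∀ i, ∑ j, B i j = 0)
    (h : ∀ i j, edgeFlow w A i j = edgeFlow w B i j) : A = B := by
  have off : ∀ i j, i ≠ j → A i j = B i j := fun i j hij => by
    simpa [edgeFlow, hij, (hw i).ne'] using h i j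
  ext i j
  by_cases hij : i = j
  · subst hij
    have h1 := (Finset.sum_erase_add _ (A i) (Finset.mem_univ i)).trans (hA i)
    have h2 := (Finset.sum_erase_add _ (B i) (Finset.mem_univ i)).trans (hB i)
    have h3 : ∑ j ∈ Finset.univ.erase i, A i j = ∑ j ∈ Finset.univ.erase i, B i j :=
      Finset.sum_congr rfl fun j hj => off i j (Finset.ne_of_mem_erase hj).symm
    linarith
  · exact off i j hij

lemma sum_cycleISM {n : ℕ} (w : Fin n → ℝ) (c : Fin n → Fin n → Prop) (i : Fin n) :
    ∑ j, cycleISM w c i j = 0 := by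
  rw [← Finset.sum_erase_add _ _ (Finset.mem_univ i), add_eq_zero_iff_eq_neg]
  simp only [cycleISM, Matrix.of_apply, if_true, neg_neg]
  exact Finset.sum_congr rfl fun j hj => if_neg (Finset.ne_of_mem_erase hj).symm

lemma edgeFlow_cycleISM {n : ℕ} {w : Fin n → ℝ} (hw : ∀ i, 0 < w i)
    {c : Fin n → Fin n → Prop} (hc : ∀ i, ¬ c i i) (i j : Fin n) :
    edgeFlow w (cycleISM w c) i j = arcIndicator c i j := by
  by_cases hij : i = j
  · subst hij
    simp [edgeFlow, arcIndicator, hc]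
  · simp [edgeFlow, arcIndicator, cycleISM, hij, (hw i).ne']

lemma edgeFlow_sum {n k : ℕ} (w : Fin n → ℝ) (α : Fin k → ℝ)
    (C : Fin k → Matrix (Fin n) (Fin n) ℝ) (i j : Fin n) :
    edgeFlow w (∑ t, α t • C t) i j = ∑ t, α t * edgeFlow w (C t) i j := by
  by_cases hij : i = j
  · simp [edgeFlow, hij]
  · simp [edgeFlow, hij, Matrix.sum_apply, Finset.mul_sum, mul_left_comm]

lemma sum_row_sum_smul {n k : ℕ} (α : Fin k → ℝ) {C : Fin k → Matrix (Fin n) (Fin n) ℝ}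
    (hC : ∀ t i, ∑ j, C t i j = 0) (i : Fin n) : ∑ j, (∑ t, α t • C t) i j = 0 := by
  simp only [Matrix.sum_apply, Matrix.smul_apply, smul_eq_mul]
  rw [Finset.sum_comm]
  simp [← Finset.mul_sum, hC]

/-- Proposition 2 (first part): for `w` in the interior of the simplex and
`G_1, …, G_k` (`k ≥ 1`) the cycles of `G` with associated ISMs `C_1, …, C_k`, the
set of relaxed `w`-feasible dynamics `Â_G(w)` is the convex cone `Co[C_1,…,C_k]`. -/
theorem relaxed_feasible_eq_cone_of_cycles
    (n k : ℕ) (hn : 1 ≤ n) (hk : 1 ≤ k)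
    (E : Fin n → Fin n → Prop) (hsimple : ∀ i, ¬ E i i)
    (w : Fin n → ℝ) (hw : ∀ i, 0 < w i) (hw1 : ∑ i, w i = 1)
    (Gc : Fin k → Fin n → Fin n → Prop)
    (hcyc : ∀ t, IsCycleOf E (Gc t)) (hinj : Function.Injective Gc)
    (hall : ∀ c, IsCycleOf E c → ∃ t, Gc t = c) :
    {A : Matrix (Fin n) (Fin n) ℝ | IsISM A ∧ InPattern E A ∧ Aᵀ *ᵥ w = 0} =
      {A | ∃ α : Fin k → ℝ, (∀ t, 0 ≤ α t) ∧ A = ∑ t, α t • cycleISM w (Gc t)} := by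
  have hrow := sum_row_sum_smul (C := fun t => cycleISM w (Gc t)) (hC := fun t => sum_cycleISM w _)
  have hflow : ∀ (α : Fin k → ℝ) i j, edgeFlow w (∑ t, α t • cycleISM w (Gc t)) i j =
      ∑ t, α t * arcIndicator (Gc t) i j := fun α i j => by
    simp only [edgeFlow_sum, edgeFlow_cycleISM hw (hcyc _).irrefl]
  ext A
  constructor
  · rintro ⟨⟨hA, hA0⟩, hAE, hAw⟩
    have hf : IsCirculation (edgeFlow w A) := by
      refine ⟨fun i j => ?_, fun i => if_pos rfl, (transpose_mulVec_eq_zero_iff hA0).1 hAw⟩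
      by_cases hij : i = j
      · simp [edgeFlow, hij]
      · simpa [edgeFlow, hij] using mul_nonneg (hw i).le (hA i j hij)
    obtain ⟨α, hα, hsum⟩ := hf.eq_sum_cycles hall fun i j h => by
      by_contra hE
      by_cases hij : i = j
      · simp [edgeFlow, hij] at h
      · simp [edgeFlow, hij, hAE i j hij hE] at h
    exact ⟨α, hα, edgeFlow_injective hw hA0 (hrow α) fun i j => by rw [hsum, hflow]⟩
  · rintro ⟨α, hα, rfl⟩
    have hoff : ∀ i j, i ≠ j → w i * (∑ t, α t • cycleISM w (Gc t)) i j =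
        ∑ t, α t * arcIndicator (Gc t) i j := fun i j hij => by
      rw [← hflow, edgeFlow, if_neg hij]
    refine ⟨⟨fun i j hij => ?_, hrow α⟩, fun i j hij hE => ?_,
      (transpose_mulVec_eq_zero_iff (hrow α)).2 fun j => ?_⟩
    · refine nonneg_of_mul_nonneg_right ?_ (hw i)
      rw [hoff i j hij]
      exact Finset.sum_nonneg fun t _ => mul_nonneg (hα t) ((hcyc t).isCirculation.nonneg i j)
    · refine (mul_eq_zero.1 ((hoff i j hij).trans ?_)).resolve_left (hw i).ne'
      refine Finset.sum_eq_zero fun t _ => ?_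
      rw [arcIndicator, if_neg fun h => hE ((hcyc t).le h), mul_zero]
    · simp only [hflow]
      rw [Finset.sum_comm, Finset.sum_comm (s := Finset.univ (α := Fin n))]
      simp only [← Finset.mul_sum, (hcyc _).isCirculation.balanced]
end
end
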